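/- Let M be the dynamic topological model on ℝ (standard topology) with S(x) = 2x, ⟦p⟧ = (−∞,1) and ⟦q⟧ = (0,∞). Then 0 ∉ ⟦□(p∨q) → □p ∨ ◇q⟧ and 0 ∉ ⟦□(p∨q) ∧ □(◦q→q) → □p ∨ q⟧. Consequently, the formulas CD(p,q) = □(p∨q) → □p ∨ ◇q and BI(p,q) = □(p∨q) ∧ □(◦q→q) → □p ∨ q are not valid over the class of invertible dynamical systems based on ℝ. -/

import Mathlib

/-- Formulas of the language `L` of intuitionistic linear temporal logic. -/
inductive Formula : Type
  | bot : Formula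
  | var : ℕ → Formula
  | and : Formula → Formula → Formula
  | or : Formula → Formula → Formula
  | impl : Formula → Formula → Formula
  | next : Formula → Formula
  | diam : Formula → Formula
  | box : Formula → Formula
deriving DecidableEq

namespace Formula

/-- `¬φ` abbreviates `φ → ⊥`. -/
def neg (φ : Formula) : Formula := impl φ bot

/-- `φ ↔ ψ` abbreviates `(φ → ψ) ∧ (ψ → φ)`. -/
def iff (φ ψ : Formula) : Formula := and (impl φ ψ) (impl ψ φ)

end Formula

/-- Derivability in `ITL⁰` extended with an additional set of axioms `Ax`.
The intuitionistic propositional tautologies are generated by a standard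
complete Hilbert-style axiomatization of intuitionistic propositional logic
(closed under modus ponens). -/
inductive ITL (Ax : Formula → Prop) : Formula → Prop
  | extra {φ} : Ax φ → ITL Ax φ
  -- (i) intuitionistic propositional axioms
  | then1 (φ ψ : Formula) : ITL Ax (.impl φ (.impl ψ φ))
  | then2 (φ ψ χ : Formula) :
      ITL Ax (.impl (.impl φ (.impl ψ χ)) (.impl (.impl φ ψ) (.impl φ χ)))
  | andE1 (φ ψ : Formula) : ITL Ax (.impl (.and φ ψ) φ)
  | andE2 (φ ψ : Formula) : ITL Ax (.impl (.and φ ψ) ψ)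
  | andI (φ ψ : Formula) : ITL Ax (.impl φ (.impl ψ (.and φ ψ)))
  | orI1 (φ ψ : Formula) : ITL Ax (.impl φ (.or φ ψ))
  | orI2 (φ ψ : Formula) : ITL Ax (.impl ψ (.or φ ψ))
  | orE (φ ψ χ : Formula) :
      ITL Ax (.impl (.impl φ χ) (.impl (.impl ψ χ) (.impl (.or φ ψ) χ)))
  | botE (φ : Formula) : ITL Ax (.impl .bot φ)
  -- (ii)–(x) temporal axioms
  | nextBot : ITL Ax (.neg (.next .bot))
  | nextAnd (φ ψ : Formula) :
      ITL Ax (.iff (.next (.and φ ψ)) (.and (.next φ) (.next ψ)))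
  | nextOr (φ ψ : Formula) :
      ITL Ax (.iff (.next (.or φ ψ)) (.or (.next φ) (.next ψ)))
  | nextK (φ ψ : Formula) :
      ITL Ax (.impl (.next (.impl φ ψ)) (.impl (.next φ) (.next ψ)))
  | boxK (φ ψ : Formula) :
      ITL Ax (.impl (.box (.impl φ ψ)) (.impl (.box φ) (.box ψ)))
  | diamK (φ ψ : Formula) :
      ITL Ax (.impl (.box (.impl φ ψ)) (.impl (.diam φ) (.diam ψ)))
  | diamOr (φ ψ : Formula) :
      ITL Ax (.impl (.diam (.or φ ψ)) (.or (.diam φ) (.diam ψ)))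
  | boxFix (φ : Formula) : ITL Ax (.impl (.box φ) (.and φ (.next (.box φ))))
  | diamFix (φ : Formula) : ITL Ax (.impl (.or φ (.next (.diam φ))) (.diam φ))
  -- rules (xi)–(xiv)
  | ind1 {φ : Formula} : ITL Ax (.impl φ (.next φ)) → ITL Ax (.impl φ (.box φ))
  | ind2 {φ : Formula} : ITL Ax (.impl (.next φ) φ) → ITL Ax (.impl (.diam φ) φ)
  | mp {φ ψ : Formula} : ITL Ax (.impl φ ψ) → ITL Ax φ → ITL Ax ψ
  | nec {φ : Formula} : ITL Ax φ → ITL Ax (.next φ)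

/-- The Fischer Servi axiom schemes FS◦ and FS◇. -/
def FSAx : Formula → Prop := fun χ => ∃ φ ψ : Formula,
  χ = .impl (.impl (.next φ) (.next ψ)) (.next (.impl φ ψ)) ∨
  χ = .impl (.impl (.diam φ) (.box ψ)) (.box (.impl φ ψ))

/-- The constant domain axiom scheme CD. -/
def CDAx : Formula → Prop := fun χ => ∃ φ ψ : Formula,
  χ = .impl (.box (.or φ ψ)) (.or (.box φ) (.diam ψ))

/-- The logic ITL⁰. -/
def ITL0 : Formula → Prop := ITL (fun _ => False)

/-- The logic ITL^FS = ITL⁰ + FS◦ + FS◇. -/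
def ITLFS : Formula → Prop := ITL FSAx

/-- The logic ITL^CD = ITL⁰ + CD. -/
def ITLCD : Formula → Prop := ITL CDAx

/-- The logic ITL¹ = ITL^FS + ITL^CD. -/
def ITL1 : Formula → Prop := ITL (fun χ => FSAx χ ∨ CDAx χ)

/-- A valuation on a dynamical topological system `(X, T, S)`: a map from
formulas to open sets satisfying the semantic clauses. -/
structure DTValuation (X : Type) (T : TopologicalSpace X) (S : X → X) where
  val : Formula → Set X
  isOpen_val : ∀ φ, @IsOpen X T (val φ)
  val_bot : val .bot = ∅
  val_and : ∀ φ ψ, val (.and φ ψ) = val φ ∩ val ψ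
  val_or : ∀ φ ψ, val (.or φ ψ) = val φ ∪ val ψ
  val_impl : ∀ φ ψ, val (.impl φ ψ) = @interior X T ((val φ)ᶜ ∪ val ψ)
  val_next : ∀ φ, val (.next φ) = S ⁻¹' val φ
  val_diam : ∀ φ, val (.diam φ) = ⋃ n : ℕ, (S^[n]) ⁻¹' val φ
  val_box : ∀ φ, val (.box φ) =
    ⋃₀ {U : Set X | @IsOpen X T U ∧ S '' U ⊆ U ∧ U ⊆ val φ}

/-- The up-set topology of a preorder: the open sets are the upward closed sets. -/
def upsetTopology (X : Type) [Preorder X] : TopologicalSpace X where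
  IsOpen U := IsUpperSet U
  isOpen_univ := isUpperSet_univ
  isOpen_inter := fun _ _ hU hV => hU.inter hV
  isOpen_sUnion := fun _ hs => isUpperSet_sUnion hs

/-- The propositional variables `p` and `q`. -/
def pVar : Formula := .var 0
def qVar : Formula := .var 1

/-- The constant domain formula CD(p,q) = □(p∨q) → □p ∨ ◇q. -/
def CDpq : Formula :=
  .impl (.box (.or pVar qVar)) (.or (.box pVar) (.diam qVar))

/-- The backward induction formula BI(p,q) = □(p∨q) ∧ □(◦q→q) → □p ∨ q. -/
def BIpq : Formula :=
  .impl (.and (.box (.or pVar qVar)) (.box (.impl (.next qVar) qVar)))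
    (.or (.box pVar) qVar)

/-- The set assigned to a formula by the semantic clauses, given the sets assigned to variables. -/
def Formula.eval {X : Type} [TopologicalSpace X] (S : X → X) (v : ℕ → Set X) : Formula → Set X
  | .bot => ∅
  | .var n => v n
  | .and φ ψ => φ.eval S v ∩ ψ.eval S v
  | .or φ ψ => φ.eval S v ∪ ψ.eval S v
  | .impl φ ψ => interior ((φ.eval S v)ᶜ ∪ ψ.eval S v)
  | .next φ => S ⁻¹' φ.eval S v
  | .diam φ => ⋃ n : ℕ, (S^[n]) ⁻¹' φ.eval S v
  | .box φ => ⋃₀ {U : Set X | IsOpen U ∧ S '' U ⊆ U ∧ U ⊆ φ.eval S v}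

theorem Formula.isOpen_eval {X : Type} [TopologicalSpace X] {S : X → X} (hS : Continuous S)
    {v : ℕ → Set X} (hv : ∀ n, IsOpen (v n)) (φ : Formula) : IsOpen (φ.eval S v) := by
  induction φ with
  | bot => exact isOpen_empty
  | var n => exact hv n
  | and φ ψ hφ hψ => exact hφ.inter hψ
  | or φ ψ hφ hψ => exact hφ.union hψ
  | impl φ ψ => exact isOpen_interior
  | next φ hφ => exact hφ.preimage hS
  | diam φ hφ => exact isOpen_iUnion fun n => hφ.preimage (hS.iterate n)
  | box φ => exact isOpen_sUnion fun U hU => hU.1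

/-- The valuation on a dynamical system extending an assignment of open sets to variables. -/
def DTValuation.ofVars {X : Type} [T : TopologicalSpace X] {S : X → X} (hS : Continuous S)
    (v : ℕ → Set X) (hv : ∀ n, IsOpen (v n)) : DTValuation X T S where
  val := Formula.eval S v
  isOpen_val := Formula.isOpen_eval hS hv
  val_bot := rfl
  val_and _ _ := rfl
  val_or _ _ := rfl
  val_impl _ _ := rfl
  val_next _ := rfl
  val_diam _ := rfl
  val_box _ := rfl

namespace DTValuation

variable {X : Type} {T : TopologicalSpace X} {S : X → X} (V : DTValuation X T S)

theorem val_box_eq_univ {φ : Formula} (h : V.val φ = Set.univ) :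
    V.val (.box φ) = Set.univ := by
  rw [V.val_box]
  exact Set.eq_univ_of_univ_subset
    (Set.subset_sUnion_of_mem ⟨isOpen_univ, Set.subset_univ _, h.ge⟩)

theorem val_impl_subset_of_eq_univ {φ ψ : Formula} (h : V.val φ = Set.univ) :
    V.val (.impl φ ψ) ⊆ V.val ψ := by
  rw [V.val_impl, h, Set.compl_univ, Set.empty_union]
  exact interior_subset

end DTValuation

theorem iterate_two_mul (n : ℕ) (x : ℝ) : (fun x : ℝ => 2 * x)^[n] x = 2 ^ n * x := by
  simp [mul_left_iterate]

/-- An open neighbourhood of `0` invariant under doubling contains a point `≥ 1`. -/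
theorem exists_one_le_mem_of_doubling_invariant {U : Set ℝ} (hU : IsOpen U)
    (hinv : (fun x : ℝ => 2 * x) '' U ⊆ U) (h0 : (0 : ℝ) ∈ U) : ∃ x ∈ U, 1 ≤ x := by
  obtain ⟨ε, hε, hball⟩ := Metric.isOpen_iff.1 hU 0 h0
  have hmem : ε / 2 ∈ U := hball (by
    rw [Metric.mem_ball, Real.dist_eq, sub_zero, abs_of_pos (half_pos hε)]
    exact half_lt_self hε)
  obtain ⟨n, hn⟩ := pow_unbounded_of_one_lt (ε / 2)⁻¹ one_lt_two
  refine ⟨2 ^ n * (ε / 2), ?_, ?_⟩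
  · rw [← iterate_two_mul]
    exact (Set.mapsTo_iff_image_subset.2 hinv).iterate n hmem
  · exact ((inv_lt_iff_one_lt_mul₀ (half_pos hε)).1 hn).le

section DoublingModel

variable (V : DTValuation ℝ inferInstance (fun x : ℝ => 2 * x))

theorem zero_notMem_val_box_pVar (hp : V.val pVar = Set.Iio 1) :
    (0 : ℝ) ∉ V.val (.box pVar) := by
  rw [V.val_box, hp]
  rintro ⟨U, ⟨hU, hinv, hsub⟩, h0⟩
  obtain ⟨x, hxU, hx⟩ := exists_one_le_mem_of_doubling_invariant hU hinv h0
  exact (hsub hxU).not_ge hx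

theorem val_box_pVar_or_qVar (hp : V.val pVar = Set.Iio 1) (hq : V.val qVar = Set.Ioi 0) :
    V.val (.box (.or pVar qVar)) = Set.univ :=
  V.val_box_eq_univ (by rw [V.val_or, hp, hq, Set.Iio_union_Ioi_of_lt one_pos])

theorem zero_notMem_val_CDpq (hp : V.val pVar = Set.Iio 1) (hq : V.val qVar = Set.Ioi 0) :
    (0 : ℝ) ∉ V.val CDpq := by
  intro h
  have h' := V.val_impl_subset_of_eq_univ (val_box_pVar_or_qVar V hp hq) h
  rw [V.val_or] at h'
  refine h'.elim (zero_notMem_val_box_pVar V hp) fun hd => ?_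
  rw [V.val_diam, hq] at hd
  obtain ⟨n, hn⟩ := Set.mem_iUnion.1 hd
  rw [Set.mem_preimage, iterate_two_mul, mul_zero] at hn
  exact Set.self_notMem_Ioi hn

theorem zero_notMem_val_BIpq (hp : V.val pVar = Set.Iio 1) (hq : V.val qVar = Set.Ioi 0) :
    (0 : ℝ) ∉ V.val BIpq := by
  intro h
  have hstep : V.val (.impl (.next qVar) qVar) = Set.univ := by
    have hnext : (fun x : ℝ => 2 * x) ⁻¹' Set.Ioi 0 = Set.Ioi 0 := by
      ext x
      simp
    rw [V.val_impl, V.val_next, hq, hnext, Set.compl_union_self, interior_univ]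
  have h' := V.val_impl_subset_of_eq_univ (by
    rw [V.val_and, val_box_pVar_or_qVar V hp hq, V.val_box_eq_univ hstep, Set.inter_univ]) h
  rw [V.val_or, hq] at h'
  exact h'.elim (zero_notMem_val_box_pVar V hp) Set.self_notMem_Ioi

end DoublingModel

theorem isHomeomorph_two_mul : IsHomeomorph (fun x : ℝ => 2 * x) :=
  (Homeomorph.mulLeft₀ (2 : ℝ) two_ne_zero).isHomeomorph

theorem exists_doubling_model : ∃ V : DTValuation ℝ inferInstance (fun x : ℝ => 2 * x),
    V.val pVar = Set.Iio 1 ∧ V.val qVar = Set.Ioi 0 :=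
  ⟨.ofVars isHomeomorph_two_mul.continuous (fun n => if n = 0 then Set.Iio 1 else Set.Ioi 0)
    (fun n => by
      split_ifs
      exacts [isOpen_Iio, isOpen_Ioi]), rfl, rfl⟩

/-- Proposition 3: the counter-model on `ℝ` with `S x = 2x`, `⟦p⟧ = (-∞,1)`,
`⟦q⟧ = (0,∞)` refutes CD(p,q) and BI(p,q) at `0`; consequently neither formula
is valid over the class of invertible dynamical systems based on `ℝ`. -/
theorem cd_bi_not_valid_on_R :
    (∀ V : DTValuation ℝ inferInstance (fun x : ℝ => 2 * x),
      V.val pVar = Set.Iio 1 → V.val qVar = Set.Ioi 0 →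
      (0 : ℝ) ∉ V.val CDpq ∧ (0 : ℝ) ∉ V.val BIpq) ∧
    ¬ (∀ S : ℝ → ℝ, IsHomeomorph S →
        ∀ V : DTValuation ℝ inferInstance S, V.val CDpq = Set.univ) ∧
    ¬ (∀ S : ℝ → ℝ, IsHomeomorph S →
        ∀ V : DTValuation ℝ inferInstance S, V.val BIpq = Set.univ) := by
  obtain ⟨V, hp, hq⟩ := exists_doubling_model
  refine ⟨fun V hp hq => ⟨zero_notMem_val_CDpq V hp hq, zero_notMem_val_BIpq V hp hq⟩,
    fun h => zero_notMem_val_CDpq V hp hq ?_, fun h => zero_notMem_val_BIpq V hp hq ?_⟩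
  all_goals
    rw [h _ isHomeomorph_two_mul V]
    exact Set.mem_univ _
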